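/- Let A be a finitary hereditary abelian category over a finite field, t an odd positive integer, A_1^• = (A_1^i, 0)_{i∈Z_t}, A_2^• = (A_2^i, 0)_{i∈Z_t}, X^• = (X^i, 0)_{i∈Z_t} t-periodic complexes with zero differentials, and S^i ∈ A fixed for each i ∈ Z_t. Let ε be the disjoint union, over isomorphism classes of t-periodic complexes C^• with homology H(C^•) ≅ X^• in D_t(A) and Im(d^i_{C^•}) ≅ S^{i+1} for all i, of the sets Ext^1_{C_t(A)}(A_1^•, A_2^•)_{C^•} of extension classes with middle term C^•; and let G be the disjoint union over tuples ([M^i]), ([N^i]) of isomorphism classes in A of the orbit spaces G_{M^•,N^•}/Aut(X^•), where G_{M^•,N^•} is the set of exact 3t-periodic complexes (m^•, n^•, h^•) with components A_2^i →^{m^i} X^i →^{n^i} A_1^i →^{h^i} A_2^{i+1} satisfying Im(h^i) ≅ S^{i+1}, Ker(h^i) ≅ M^i, Coker(h^i) ≅ N^{i+1}, and Aut(X^•) = ∏_i Aut(X^i) acts by (l_{X^i}) · (m^•,n^•,h^•) = (l_{X^i} m^i, n^i l_{X^i}^{-1}, h^i). Then there exists a surjective map Φ : ε ↠ G. -/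

import Mathlib

/-!
STATEMENT 16.
Let `A` be a finitary hereditary abelian category over a finite field, `t` an odd
positive integer, `A₁^•, A₂^•, X^•` `t`-periodic complexes with zero differentials and
`S^i ∈ A` fixed.  Let `ε` be the disjoint union, over isomorphism classes of `t`-periodic
complexes `C^•` with `H(C^•) ≅ X^•` and `Im(d^i) ≅ S^{i+1}`, of the sets
`Ext¹_{C_t(A)}(A₁^•, A₂^•)_{C^•}` of extension classes with middle term `C^•`; and let
`G` be the disjoint union over pairs of tuples of isomorphism classes `([M^i]), ([N^i])`
of the orbit spaces `G_{M^•,N^•}/Aut(X^•)`.  Then there exists a surjective map `ε ↠ G`.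
-/

open CategoryTheory CategoryTheory.Limits

noncomputable section

namespace GreenDH

def IsoCl (C : Type*) [Category C] : Type _ := Quotient (CategoryTheory.isIsomorphicSetoid C)

def IsoCl.out {C : Type*} [Category C] (s : IsoCl C) : C := Quotient.out s

/-- Short exact sequences `0 → b → c → a → 0` with middle term `c`. -/
def sesSet {C : Type*} [Category C] [Abelian C] (a b c : C) : Type _ :=
  {p : (b ⟶ c) × (c ⟶ a) // ∃ w : p.1 ≫ p.2 = 0, (ShortComplex.mk p.1 p.2 w).ShortExact}

/-- `Ext¹(a, b)_c`: extension classes of `a` by `b` with middle term isomorphic to `c`. -/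
def extWithMiddle {C : Type*} [Category C] [Abelian C] (a b c : C) : Type _ :=
  Quot (fun (p q : sesSet a b c) =>
    ∃ l : c ≅ c, p.1.1 ≫ l.hom = q.1.1 ∧ l.hom ≫ q.1.2 = p.1.2)

/-- the pair `(f, g)` is exact at the middle object. -/
def exactProp {A : Type} [SmallCategory A] [Abelian A] {X Y Z : A}
    (f : X ⟶ Y) (g : Y ⟶ Z) : Prop :=
  ∃ w : f ≫ g = 0, (ShortComplex.mk f g w).Exact

def pShape (t : ℕ) : ComplexShape (ZMod t) := ComplexShape.up' (1 : ZMod t)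

abbrev Ct (A : Type) [SmallCategory A] [Abelian A] (t : ℕ) :=
  HomologicalComplex A (pShape t)

def mkZero {A : Type} [SmallCategory A] [Abelian A] {t : ℕ} (f : ZMod t → A) : Ct A t where
  X := f
  d _ _ := 0
  shape _ _ _ := rfl
  d_comp_d' := by intros; simp

variable {A : Type} [SmallCategory A] [Abelian A] {t : ℕ}

/-- The index of the disjoint union `ε`: isomorphism classes of `t`-periodic complexes
`C^•` with homology `H(C^•) ≅ X^•` and `Im(d^i_{C^•}) ≅ S^{i+1}` for all `i`. -/
def epsIdx (X S : ZMod t → A) : Type _ :=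
  {c : IsoCl (Ct A t) //
    (∀ i : ZMod t, Nonempty ((IsoCl.out c).homology i ≅ X i)) ∧
    (∀ i : ZMod t, Nonempty (Limits.image ((IsoCl.out c).d i (i + 1)) ≅ S (i + 1)))}

/-- The set `ε`: the disjoint union of the sets of extension classes
`Ext¹_{C_t(A)}(A₁^•, A₂^•)_{C^•}`. -/
def eps (A1 A2 X S : ZMod t → A) : Type _ :=
  Σ c : epsIdx X S, extWithMiddle (mkZero A1) (mkZero A2) c.1.out

/-- One period `A₂^i ⟶m X^i ⟶n A₁^i ⟶h A₂^{i+1}` of a `3t`-periodic complex. -/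
structure RawTriple (A1 A2 X : ZMod t → A) (i : ZMod t) where
  m : A2 i ⟶ X i
  n : X i ⟶ A1 i
  h : A1 i ⟶ A2 (i + 1)

def Raw (A1 A2 X : ZMod t → A) : Type _ := ∀ i : ZMod t, RawTriple A1 A2 X i

/-- The set `G_{M^•,N^•}` of exact `3t`-periodic complexes with
`Im(h^i) ≅ S^{i+1}`, `Ker(h^i) ≅ M^i`, `Coker(h^i) ≅ N^{i+1}`. -/
def GSet (A1 A2 X S M N : ZMod t → A) : Set (Raw A1 A2 X) :=
  {r | (∀ i : ZMod t,
          exactProp (r i).m (r i).n ∧ exactProp (r i).n (r i).h ∧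
            exactProp (r i).h (r (i + 1)).m) ∧
       (∀ i : ZMod t,
          Nonempty (Limits.image (r i).h ≅ S (i + 1)) ∧
            Nonempty (kernel (r i).h ≅ M i) ∧
            Nonempty (cokernel (r i).h ≅ N (i + 1)))}

/-- The orbit space `G_{M^•,N^•} / Aut(X^•)`, for the action
`(l_{X^i}) · (m, n, h) = (l_{X^i} ∘ m, n ∘ l_{X^i}⁻¹, h)`. -/
def GOrb (A1 A2 X S M N : ZMod t → A) : Type _ :=
  Quot (fun (r r' : GSet A1 A2 X S M N) =>
    ∃ l : ∀ i : ZMod t, X i ≅ X i, ∀ i : ZMod t,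
      (r'.1 i).m = (r.1 i).m ≫ (l i).hom ∧
      (r'.1 i).n = (l i).inv ≫ (r.1 i).n ∧
      (r'.1 i).h = (r.1 i).h)

/-- The set `𝒢`: the disjoint union of the orbit spaces `G_{M^•,N^•}/Aut(X^•)` over all
tuples of isomorphism classes `([M^i])_i` and `([N^i])_i`. -/
def GTotal (A1 A2 X S : ZMod t → A) : Type _ :=
  Σ MN : (ZMod t → IsoCl A) × (ZMod t → IsoCl A),
    GOrb A1 A2 X S (fun i => (MN.1 i).out) (fun i => (MN.2 i).out)

open Pretriangulated DerivedCategory in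
lemma realize {A : Type} [SmallCategory A] [Abelian A] [HasDerivedCategory.{0} A] {Z B : A}
    (β : (singleFunctor A 0).obj Z ⟶ ((singleFunctor A 0).obj B)⟦(1:ℤ)⟧) :
    ∃ (K : A) (a : B ⟶ K) (b : K ⟶ Z) (w : a ≫ b = 0), (ShortComplex.mk a b w).ShortExact ∧
      Triangle.mk ((singleFunctor A 0).map a) ((singleFunctor A 0).map b) β ∈
        distTriang (DerivedCategory A) := by
  obtain ⟨E, f, g, hT⟩ := distinguished_cocone_triangle₂ β
  have : TStructure.t.IsLE E 0 := TStructure.t.isLE₂ _ hT 0 (inferInstanceAs (TStructure.t.IsLE ((singleFunctor A 0).obj B) 0)) (inferInstanceAs (TStructure.t.IsLE ((singleFunctor A 0).obj Z) 0))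
  have : TStructure.t.IsGE E 0 := TStructure.t.isGE₂ _ hT 0 (inferInstanceAs (TStructure.t.IsGE ((singleFunctor A 0).obj B) 0)) (inferInstanceAs (TStructure.t.IsGE ((singleFunctor A 0).obj Z) 0))
  obtain ⟨K, ⟨e⟩⟩ := exists_iso_singleFunctor_obj_of_isGE_of_isLE E 0
  obtain ⟨a, ha⟩ := (singleFunctor A 0).map_surjective (f ≫ e.hom)
  obtain ⟨b, hb⟩ := (singleFunctor A 0).map_surjective (e.inv ≫ g)
  have hT' : Triangle.mk ((singleFunctor A 0).map a) ((singleFunctor A 0).map b) β ∈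
        distTriang (DerivedCategory A) := by
    refine isomorphic_distinguished _ hT _ (Triangle.isoMk _ _ (Iso.refl _) e.symm (Iso.refl _) ?_ ?_ ?_)
    · exact (by rw [ha]; simp : (singleFunctor A 0).map a ≫ e.inv = 𝟙 _ ≫ f)
    · exact (by rw [hb]; simp : (singleFunctor A 0).map b ≫ 𝟙 _ = e.inv ≫ g)
    · exact (by simp : β ≫ (shiftFunctor (DerivedCategory A) (1:ℤ)).map (𝟙 ((singleFunctor A 0).obj B)) = 𝟙 _ ≫ β)
  have w : a ≫ b = 0 := by
    apply (singleFunctor A 0).map_injective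
    have h : (singleFunctor A 0).map a ≫ (singleFunctor A 0).map b = 0 :=
      comp_distTriang_mor_zero₁₂ _ hT'
    rw [Functor.map_comp, h, Functor.map_zero]
  refine ⟨K, a, b, w, ?_, hT'⟩
  have h2 := HomologySequence.exact₂ _ hT' 0
  have m : Mono ((homologyFunctor A 0).map ((singleFunctor A 0).map a)) := by
    refine (HomologySequence.mono_homologyMap_mor₁_iff _ hT' (-1) 0 (by lia)).2 ?_
    exact (isZero_of_isGE ((singleFunctor A 0).obj Z) 0 (-1) (by lia)).eq_of_src _ _
  have ep : Epi ((homologyFunctor A 0).map ((singleFunctor A 0).map b)) := by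
    refine (HomologySequence.epi_homologyMap_mor₂_iff _ hT' 0 1 (by lia)).2 ?_
    exact (isZero_of_isLE ((singleFunctor A 0).obj B) 0 1 (by lia)).eq_of_tgt _ _
  let F := singleFunctorCompHomologyFunctorIso A 0
  have := @ShortComplex.ShortExact.mk _ _ _ _ h2 m ep
  refine ShortComplex.shortExact_of_iso ?_ this
  refine ShortComplex.isoMk (F.app B) (F.app K) (F.app Z) ?_ ?_
  · exact (F.hom.naturality a).symm
  · exact (F.hom.naturality b).symm

section
variable {A : Type} [SmallCategory A] [Abelian A] [HasExt.{0} A]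

open Pretriangulated DerivedCategory in
lemma step1 {Y X Z B N : A} {y : Y ⟶ X} {z : X ⟶ Z} {w : y ≫ z = 0} 
   (hX : (ShortComplex.mk y z w).ShortExact) 
   {n : N ⟶ B} {π : B ⟶ Y} {w' : n ≫ π = 0} (hB : (ShortComplex.mk n π w').ShortExact)
   (h : Subsingleton (Abelian.Ext Z N 2)) :
   ∃ (K : A) (a : B ⟶ K) (b : K ⟶ Z) (w : a ≫ b = 0) (q : K ⟶ X),
     (ShortComplex.mk a b w).ShortExact ∧ a ≫ q = π ≫ y ∧ q ≫ z = b := by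
  let := HasDerivedCategory.standard A
  obtain ⟨β, hβ⟩ := Abelian.Ext.covariant_sequence_exact₃ Z hB hX.extClass (n₁ := 2) rfl
    (Subsingleton.elim _ _)
  obtain ⟨K, a, b, w, hS, hT⟩ := realize β.hom
  obtain ⟨q, hq1, hq2⟩ := complete_distinguished_triangle_morphism₂ _ _ hT 
    hX.singleTriangle_distinguished ((singleFunctor A 0).map π) (𝟙 _) (by
      have := congrArg Abelian.Ext.hom hβ
      simp only [Abelian.Ext.comp_hom, Abelian.Ext.mk₀_hom] at this
      rw [ShiftedHom.comp_mk₀] at this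
      exact (this.trans hX.extClass_hom).trans (Category.id_comp _).symm)
  obtain ⟨q, rfl⟩ := (singleFunctor A 0).map_surjective q
  refine ⟨K, a, b, w, q, hS, ?_, ?_⟩
  · apply (singleFunctor A 0).map_injective
    rw [Functor.map_comp, Functor.map_comp]; exact hq1
  · apply (singleFunctor A 0).map_injective
    rw [Functor.map_comp]; exact hq2.symm.trans (Category.comp_id _)

open Pretriangulated DerivedCategory in
lemma step2 {K Z B A1 W : A} {a : B ⟶ K} {b : K ⟶ Z} {w : a ≫ b = 0} 
   (hK : (ShortComplex.mk a b w).ShortExact) 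
   {z : Z ⟶ A1} {v : A1 ⟶ W} {w' : z ≫ v = 0} (hB : (ShortComplex.mk z v w').ShortExact)
   (h : Subsingleton (Abelian.Ext W B 2)) :
   ∃ (C : A) (ι : B ⟶ C) (p : C ⟶ A1) (w : ι ≫ p = 0) (j : K ⟶ C),
     (ShortComplex.mk ι p w).ShortExact ∧ a ≫ j = ι ∧ j ≫ p = b ≫ z := by
  let := HasDerivedCategory.standard A
  obtain ⟨β, hβ⟩ := Abelian.Ext.contravariant_sequence_exact₁ hB B hK.extClass (n₁ := 2) rfl
    (Subsingleton.elim _ _)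
  obtain ⟨K, a', b', w, hS, hT⟩ := realize β.hom
  obtain ⟨q, hq1, hq2⟩ := complete_distinguished_triangle_morphism₂ _ _ 
    hK.singleTriangle_distinguished hT (𝟙 _) ((singleFunctor A 0).map z)  (by
      have := congrArg Abelian.Ext.hom hβ
      simp only [Abelian.Ext.comp_hom, Abelian.Ext.mk₀_hom] at this
      rw [ShiftedHom.mk₀_comp] at this
      have h2 : hK.singleδ ≫ (shiftFunctor (DerivedCategory A) (1:ℤ)).map
        (𝟙 ((singleFunctor A 0).obj B)) = (singleFunctor A 0).map z ≫ β.hom := by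
        rw [CategoryTheory.Functor.map_id, Category.comp_id]; exact (this.trans hK.extClass_hom).symm
      exact h2)
  obtain ⟨q, rfl⟩ := (singleFunctor A 0).map_surjective q
  refine ⟨K, a', b', w, q, hS, ?_, ?_⟩
  · apply (singleFunctor A 0).map_injective
    rw [Functor.map_comp]; exact hq1.trans (Category.id_comp _)
  · apply (singleFunctor A 0).map_injective
    rw [Functor.map_comp, Functor.map_comp]; exact hq2.symm
end

section chase
variable {A : Type} [SmallCategory A] [Abelian A]

/-- `0 → b → c → a → 0` is short exact. -/
def SES {b c a : A} (f : b ⟶ c) (g : c ⟶ a) : Prop :=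
  ∃ w : f ≫ g = 0, (ShortComplex.mk f g w).ShortExact

lemma SES.mono {b c a : A} {f : b ⟶ c} {g : c ⟶ a} (h : SES f g) : Mono f := h.2.mono_f
lemma SES.epi {b c a : A} {f : b ⟶ c} {g : c ⟶ a} (h : SES f g) : Epi g := h.2.epi_g
lemma SES.zero {b c a : A} {f : b ⟶ c} {g : c ⟶ a} (h : SES f g) : f ≫ g = 0 := h.1
lemma SES.lift {b c a : A} {f : b ⟶ c} {g : c ⟶ a} (h : SES f g) {T : A} (x : T ⟶ c)
    (hx : x ≫ g = 0) : ∃ u : T ⟶ b, u ≫ f = x := by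
  obtain ⟨w, h⟩ := h
  have := h.mono_f
  exact ⟨h.exact.lift x hx, h.exact.lift_f x hx⟩
lemma SES.desc {b c a : A} {f : b ⟶ c} {g : c ⟶ a} (h : SES f g) {T : A} (x : c ⟶ T)
    (hx : f ≫ x = 0) : ∃ u : a ⟶ T, g ≫ u = x := by
  obtain ⟨w, h⟩ := h
  have := h.epi_g
  exact ⟨h.exact.desc x hx, h.exact.g_desc x hx⟩

lemma exactProp.ref {X Y Z : A} {f : X ⟶ Y} {g : Y ⟶ Z} (h : exactProp f g) {T : A} (x : T ⟶ Y)
    (hx : x ≫ g = 0) : ∃ (T' : A) (π : T' ⟶ T) (_ : Epi π) (u : T' ⟶ X), π ≫ x = u ≫ f :=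
  h.2.exact_up_to_refinements x hx

lemma exactProp_of_ref {X Y Z : A} {f : X ⟶ Y} {g : Y ⟶ Z} (w : f ≫ g = 0)
    (h : ∀ (T : A) (x : T ⟶ Y), x ≫ g = 0 →
      ∃ (T' : A) (π : T' ⟶ T) (_ : Epi π) (u : T' ⟶ X), π ≫ x = u ≫ f) : exactProp f g :=
  ⟨w, (ShortComplex.exact_iff_exact_up_to_refinements _).2 (fun T x hx => h T x hx)⟩

lemma step3 [HasExt.{0} A] (hered : ∀ X Y : A, Subsingleton (Abelian.Ext X Y 2))
    {A1 A2 X : A} {m : A2 ⟶ X} {n : X ⟶ A1} (h : exactProp m n) :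
    ∃ (C : A) (ι : A2 ⟶ C) (p : C ⟶ A1) (K : A) (a : A2 ⟶ K) (j : K ⟶ C) (q : K ⟶ X),
      SES ι p ∧ Mono j ∧ Epi q ∧ a ≫ j = ι ∧ a ≫ q = m ∧ q ≫ n = j ≫ p := by
  obtain ⟨w, h⟩ := h
  have w1 : image.ι m ≫ factorThruImage n = 0 := by
    rw [← cancel_mono (image.ι n), ← cancel_epi (factorThruImage m)]
    simp [w]
  have hX : (ShortComplex.mk (image.ι m) (factorThruImage n) w1).ShortExact := by
    have : exactProp (image.ι m) (factorThruImage n) := by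
      refine exactProp_of_ref w1 (fun T x hx => ?_)
      obtain ⟨T', π, hπ, u, hu⟩ := h.exact_up_to_refinements x (by
        show x ≫ n = 0
        rw [← image.fac n, reassoc_of% hx, zero_comp])
      refine ⟨T', π, hπ, u ≫ factorThruImage m, ?_⟩
      rw [Category.assoc, image.fac]; exact hu
    exact { exact := this.2, mono_f := by dsimp; infer_instance, epi_g := by dsimp; infer_instance }
  have hB : (ShortComplex.mk (kernel.ι (factorThruImage m)) (factorThruImage m)
      (kernel.condition _)).ShortExact :=
    { exact := ShortComplex.exact_of_f_is_kernel _ (kernelIsKernel _)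
      mono_f := by dsimp; infer_instance
      epi_g := by dsimp; infer_instance }
  have hW : (ShortComplex.mk (image.ι n) (cokernel.π (image.ι n))
      (cokernel.condition _)).ShortExact :=
    { exact := ShortComplex.exact_of_g_is_cokernel _ (cokernelIsCokernel _)
      mono_f := by dsimp; infer_instance
      epi_g := by dsimp; infer_instance }
  obtain ⟨K, a, b, wab, q, hK, haq, hqz⟩ := step1 hX hB (hered _ _)
  obtain ⟨C, ι, p, wC, j, hC, haj, hjp⟩ := step2 hK hW (hered _ _)
  have sK : SES a b := ⟨wab, hK⟩
  have sX : SES (image.ι m) (factorThruImage n) := ⟨w1, hX⟩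
  have sC : SES ι p := ⟨wC, hC⟩
  have := sC.mono
  have := sK.epi
  refine ⟨C, ι, p, K, a, j, q, sC, ?_, ?_, haj, ?_, ?_⟩
  · refine Preadditive.mono_of_cancel_zero _ (fun x hx => ?_)
    have h1 : x ≫ b = 0 := by
      rw [← cancel_mono (image.ι n), Category.assoc, ← hjp, reassoc_of% hx, zero_comp, zero_comp]
    obtain ⟨u, rfl⟩ := sK.lift x h1
    rw [Category.assoc, haj] at hx
    have : u = 0 := by rw [← cancel_mono ι, hx, zero_comp]
    rw [this, zero_comp]
  · refine Preadditive.epi_of_cancel_zero _ (fun x hx => ?_)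
    have h1 : image.ι m ≫ x = 0 := by
      rw [← cancel_epi (factorThruImage m), ← reassoc_of% haq, hx, comp_zero, comp_zero]
    obtain ⟨u, rfl⟩ := sX.desc x h1
    rw [reassoc_of% hqz] at hx
    have : u = 0 := by rw [← cancel_epi b, hx, comp_zero]
    rw [this, comp_zero]
  · rw [haq, image.fac]
  · rw [hjp, ← hqz, Category.assoc, image.fac]

variable {t : ℕ}

lemma pRel (i : ZMod t) : (pShape t).Rel i (i + 1) := rfl
lemma pnext (i : ZMod t) : (pShape t).next i = i + 1 := (pShape t).next_eq' (pRel i)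
lemma pprev (i : ZMod t) : (pShape t).prev (i + 1) = i := (pShape t).prev_eq' (pRel i)

lemma cyc_exact (c : Ct A t) (i j : ZMod t) (h : i + 1 = j) :
    exactProp (c.toCycles i j) (c.homologyπ j) :=
  ⟨c.toCycles_comp_homologyπ i j, ShortComplex.exact_of_g_is_cokernel _
    (c.homologyIsCokernel i j ((pShape t).prev_eq' h))⟩

/-- Degreewise short exactness of an extension of complexes with zero differential. -/
structure DW {A1 A2 : ZMod t → A} (c : Ct A t) (ι : ∀ i, A2 i ⟶ c.X i)
    (p : ∀ i, c.X i ⟶ A1 i) : Prop where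
  ses : ∀ i, SES (ι i) (p i)
  ιd : ∀ i j, ι i ≫ c.d i j = 0
  dp : ∀ i j, c.d i j ≫ p j = 0

/-- `r` is the long exact sequence of the extension, up to the choice of an isomorphism
between the homology and `X`. -/
def LES {A1 A2 X : ZMod t → A} (c : Ct A t) (ι : ∀ i, A2 i ⟶ c.X i)
    (p : ∀ i, c.X i ⟶ A1 i) (r : Raw A1 A2 X) : Prop :=
  (∀ i, p i ≫ (r i).h ≫ ι (i + 1) = c.d i (i + 1)) ∧
  ∃ e : ∀ i, c.homology i ≅ X i, ∀ i,
    (∃ a : A2 i ⟶ c.cycles i, a ≫ c.iCycles i = ι i ∧ a ≫ c.homologyπ i ≫ (e i).hom = (r i).m) ∧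
    c.homologyπ i ≫ (e i).hom ≫ (r i).n = c.iCycles i ≫ p i

variable {A1 A2 X : ZMod t → A}

lemma LES.exists {c : Ct A t} {ι : ∀ i, A2 i ⟶ c.X i} {p : ∀ i, c.X i ⟶ A1 i}
    (hc : DW c ι p) (e : ∀ i, c.homology i ≅ X i) : ∃ r : Raw A1 A2 X, LES c ι p r := by
  have H1 : ∀ i, ∃ h : A1 i ⟶ A2 (i + 1), p i ≫ h ≫ ι (i + 1) = c.d i (i + 1) := by
    intro i
    have := (hc.ses (i+1)).mono
    obtain ⟨u, hu⟩ := (hc.ses (i+1)).lift (c.d i (i+1)) (hc.dp _ _)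
    obtain ⟨v, hv⟩ := (hc.ses i).desc u (by
      rw [← cancel_mono (ι (i+1)), Category.assoc, hu, hc.ιd, zero_comp])
    exact ⟨v, by rw [← Category.assoc, hv, hu]⟩
  have H2 : ∀ i, ∃ n : c.homology i ⟶ A1 i, c.homologyπ i ≫ n = c.iCycles i ≫ p i := by
    intro i
    have hz : c.toCycles ((pShape t).prev i) i ≫ c.iCycles i ≫ p i = 0 := by
      rw [c.toCycles_i_assoc, hc.dp]
    exact ⟨(c.homologyIsCokernel _ i rfl).desc (CokernelCofork.ofπ _ hz),
      (c.homologyIsCokernel _ i rfl).fac (CokernelCofork.ofπ _ hz) WalkingParallelPair.one⟩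
  choose h hh using H1
  choose n hn using H2
  let a : ∀ i, A2 i ⟶ c.cycles i := fun i => c.liftCycles (ι i) (i+1) (pnext i) (hc.ιd _ _)
  refine ⟨fun i => ⟨a i ≫ c.homologyπ i ≫ (e i).hom, (e i).inv ≫ n i, h i⟩, hh, e, fun i =>
    ⟨⟨a i, ?_, rfl⟩, ?_⟩⟩
  · simp [a]
  · simp [hn]

lemma LES.exact {c : Ct A t} {ι : ∀ i, A2 i ⟶ c.X i} {p : ∀ i, c.X i ⟶ A1 i}
    (hc : DW c ι p) {r : Raw A1 A2 X} (hr : LES c ι p r) (i : ZMod t) :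
    exactProp (r i).m (r i).n ∧ exactProp (r i).n (r i).h ∧
            exactProp (r i).h (r (i + 1)).m := by
  obtain ⟨hh, e, he⟩ := hr
  have mono := fun i => (hc.ses i).mono
  have epi := fun i => (hc.ses i).epi
  obtain ⟨⟨a, ha, hm⟩, hn⟩ := he i
  obtain ⟨⟨a', ha', hm'⟩, hn'⟩ := he (i+1)
  refine ⟨exactProp_of_ref ?_ ?_, exactProp_of_ref ?_ ?_, exactProp_of_ref ?_ ?_⟩
  · rw [← hm]
    simp only [Category.assoc]
    rw [hn, reassoc_of% ha, (hc.ses i).zero]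
  · intro T x hx
    obtain ⟨T', π, hπ, k, hk⟩ := surjective_up_to_refinements_of_epi
      (c.homologyπ i ≫ (e i).hom) x
    have h1 : (k ≫ c.iCycles i) ≫ p i = 0 := by
      rw [Category.assoc, ← hn, ← reassoc_of% hk, hx, comp_zero]
    obtain ⟨u, hu⟩ := (hc.ses i).lift _ h1
    have h2 : u ≫ a = k := by
      rw [← cancel_mono (c.iCycles i), Category.assoc, ha, hu]
    exact ⟨T', π, hπ, u, by rw [hk, ← hm, reassoc_of% h2]⟩
  · rw [← cancel_mono (ι (i+1)), ← cancel_epi (c.homologyπ i ≫ (e i).hom)]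
    simp only [Category.assoc, reassoc_of% hn, hh, c.iCycles_d, zero_comp, comp_zero]
  · intro T x hx
    obtain ⟨T', π, hπ, k, hk⟩ := surjective_up_to_refinements_of_epi (p i) x
    have h1 : k ≫ c.d i (i+1) = 0 := by
      rw [← hh, ← reassoc_of% hk, reassoc_of% hx, zero_comp, comp_zero]
    refine ⟨T', π, hπ, c.liftCycles k (i+1) (pnext i) h1 ≫ c.homologyπ i ≫ (e i).hom, ?_⟩
    simp only [Category.assoc, hn, hk, c.liftCycles_i_assoc]
  · have h1 : p i ≫ (r i).h ≫ a' = c.toCycles i (i+1) := by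
      rw [← cancel_mono (c.iCycles (i+1)), c.toCycles_i, ← hh, Category.assoc, Category.assoc, ha']
    rw [← cancel_epi (p i), ← hm', reassoc_of% h1, c.toCycles_comp_homologyπ_assoc, zero_comp,
      comp_zero]
  · intro T x hx
    have h0 : (x ≫ a') ≫ c.homologyπ (i+1) = 0 := by
      rw [← cancel_mono (e (i+1)).hom, zero_comp, ← hx, ← hm']; simp only [Category.assoc]
    obtain ⟨T', π, hπ, k, hk⟩ := (cyc_exact c i _ rfl).ref _ h0
    refine ⟨T', π, hπ, k ≫ p i, ?_⟩
    rw [← cancel_mono (ι (i+1))]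
    simp only [Category.assoc, hh]
    rw [← c.toCycles_i, ← reassoc_of% hk, ha']

lemma LES.image {c : Ct A t} {ι : ∀ i, A2 i ⟶ c.X i} {p : ∀ i, c.X i ⟶ A1 i}
    (hc : DW c ι p) {r : Raw A1 A2 X} (hr : LES c ι p r) (i : ZMod t) :
    Nonempty (Limits.image (r i).h ≅ Limits.image (c.d i (i + 1))) := by
  have := (hc.ses i).epi
  have := (hc.ses (i+1)).mono
  have : StrongEpi (p i ≫ factorThruImage (r i).h) := strongEpi_of_epi _
  exact ⟨image.isoStrongEpiMono (p i ≫ factorThruImage (r i).h) (image.ι (r i).h ≫ ι (i+1))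
    (by rw [← hr.1 i]; simp)⟩

/-- Being in the same orbit. -/
def Same (r r' : Raw A1 A2 X) : Prop :=
  ∃ l : ∀ i : ZMod t, X i ≅ X i, ∀ i : ZMod t,
      (r' i).m = (r i).m ≫ (l i).hom ∧
      (r' i).n = (l i).inv ≫ (r i).n ∧
      (r' i).h = (r i).h

lemma LES.same {c : Ct A t} {ι : ∀ i, A2 i ⟶ c.X i} {p : ∀ i, c.X i ⟶ A1 i}
    (hc : DW c ι p) {r r' : Raw A1 A2 X} (hr : LES c ι p r) (hr' : LES c ι p r') :
    Same r r' := by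
  obtain ⟨hh, e, he⟩ := hr
  obtain ⟨hh', e', he'⟩ := hr'
  refine ⟨fun i => (e i).symm ≪≫ e' i, fun i => ?_⟩
  have := (hc.ses i).epi
  have := (hc.ses (i+1)).mono
  obtain ⟨⟨a, ha, hm⟩, hn⟩ := he i
  obtain ⟨⟨a', ha', hm'⟩, hn'⟩ := he' i
  have haa : a = a' := by rw [← cancel_mono (c.iCycles i), ha, ha']
  subst haa
  refine ⟨?_, ?_, ?_⟩
  · rw [← hm, ← hm']; simp
  · rw [← cancel_epi (c.homologyπ i ≫ (e' i).hom)]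
    simp [hn, hn']
  · rw [← cancel_epi (p i), ← cancel_mono (ι (i+1)), Category.assoc, Category.assoc, hh, hh']

lemma LES.transport {c c' : Ct A t} {ι : ∀ i, A2 i ⟶ c.X i} {p : ∀ i, c.X i ⟶ A1 i}
    {r : Raw A1 A2 X} (hr : LES c ι p r) (l : c ≅ c') :
    LES c' (fun i => ι i ≫ l.hom.f i) (fun i => l.inv.f i ≫ p i) r := by
  obtain ⟨hh, e, he⟩ := hr
  refine ⟨fun i => ?_, fun i => (HomologicalComplex.homologyMapIso l i).symm ≪≫ e i, fun i => ?_⟩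
  · have := hh i
    simp only [Category.assoc]
    rw [reassoc_of% this]
    simp
  · obtain ⟨⟨a, ha, hm⟩, hn⟩ := he i
    refine ⟨⟨a ≫ HomologicalComplex.cyclesMap l.hom i, ?_, ?_⟩, ?_⟩
    · simp [reassoc_of% ha]
    · rw [← hm]
      simp [← HomologicalComplex.cyclesMap_comp_assoc]
    · simp [hn]

lemma same_of_iso {c c' : Ct A t} {ι : ∀ i, A2 i ⟶ c.X i} {p : ∀ i, c.X i ⟶ A1 i}
    {ι' : ∀ i, A2 i ⟶ c'.X i} {p' : ∀ i, c'.X i ⟶ A1 i}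
    (hc' : DW c' ι' p') (l : c ≅ c') (h1 : ∀ i, ι i ≫ l.hom.f i = ι' i)
    (h2 : ∀ i, l.hom.f i ≫ p' i = p i)
    {r r' : Raw A1 A2 X} (hr : LES c ι p r) (hr' : LES c' ι' p' r') : Same r r' := by
  have := hr.transport l
  have e1 : (fun i => ι i ≫ l.hom.f i) = ι' := funext h1
  have e2 : (fun i => l.inv.f i ≫ p i) = p' := by
    funext i
    rw [← h2]
    simp [← HomologicalComplex.comp_f_assoc]
  rw [e1, e2] at this
  exact this.same hc' hr'

/-- Construction of an extension with prescribed long exact sequence. -/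
lemma LES.construct [HasExt.{0} A] (hered : ∀ X Y : A, Subsingleton (Abelian.Ext X Y 2))
    (r : Raw A1 A2 X) (hr : ∀ i : ZMod t,
          exactProp (r i).m (r i).n ∧ exactProp (r i).n (r i).h ∧
            exactProp (r i).h (r (i + 1)).m) :
    ∃ (c : Ct A t) (ι : ∀ i, A2 i ⟶ c.X i) (p : ∀ i, c.X i ⟶ A1 i), DW c ι p ∧ LES c ι p r := by
  choose C ι p K a j q hS hj hq haj haq hqn using fun i => step3 hered (hr i).1
  let c : Ct A t :=
    { X := C
      d := fun i j => if h : i + 1 = j then p i ≫ (r i).h ≫ ι (i+1) ≫ eqToHom (by rw [h]) else 0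
      shape := fun i j h => dif_neg h
      d_comp_d' := by
        rintro i _ _ rfl rfl
        have := (hS (i+1)).zero
        simp [reassoc_of% this] }
  have hd : ∀ i, c.d i (i+1) = p i ≫ (r i).h ≫ ι (i+1) := fun i => by simp [c]
  have hd0 : ∀ i j, ¬ (i + 1 = j) → c.d i j = 0 := fun i j h => dif_neg h
  have hD : DW c ι p := by
    refine ⟨hS, fun i j => ?_, fun i j => ?_⟩
    · by_cases h : i + 1 = j
      · subst h
        have := (hS i).zero
        rw [hd, reassoc_of% this, zero_comp]
      · rw [hd0 _ _ h, comp_zero]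
    · by_cases h : i + 1 = j
      · subst h
        rw [hd]
        have := (hS (i+1)).zero
        simp only [Category.assoc, this, comp_zero]
      · rw [hd0 _ _ h, zero_comp]
  refine ⟨c, ι, p, hD, fun i => (hd i).symm, ?_⟩
  have mono := fun i => (hS i).mono
  have epi := fun i => (hS i).epi
  -- the cycles
  have hjd : ∀ i, j i ≫ c.d i (i+1) = 0 := fun i => by
    have h1 := (hr i).2.1.1
    rw [hd, ← reassoc_of% (hqn i), reassoc_of% h1, zero_comp, comp_zero]
  let k : ∀ i, K i ⟶ c.cycles i := fun i => c.liftCycles (j i) (i+1) (pnext i) (hjd i)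
  have hk : ∀ i, k i ≫ c.iCycles i = j i := fun i => by simp [k]
  have hkm : ∀ i, Mono (k i) := fun i => by
    have : Mono (k i ≫ c.iCycles i) := by rw [hk]; exact hj i
    exact mono_of_mono _ (c.iCycles i)
  have hke : ∀ i, Epi (k i) := fun i => by
    rw [epi_iff_surjective_up_to_refinements]
    intro T x
    have h1 : (x ≫ c.iCycles i ≫ p i) ≫ (r i).h = 0 := by
      rw [← cancel_mono (ι (i+1))]
      simp only [Category.assoc, ← hd, c.iCycles_d, comp_zero, zero_comp]
    obtain ⟨T', π, hπ, u, hu⟩ := (hr i).2.1.ref _ h1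
    obtain ⟨T'', π', hπ', v, hv⟩ := surjective_up_to_refinements_of_epi (q i) u
    obtain ⟨w, hw⟩ := (hS i).lift (π' ≫ π ≫ x ≫ c.iCycles i - v ≫ j i) (by
      rw [Preadditive.sub_comp]
      simp only [Category.assoc]
      rw [hu, reassoc_of% hv, hqn, sub_self])
    refine ⟨T'', π' ≫ π, inferInstance, v + w ≫ a i, ?_⟩
    rw [← cancel_mono (c.iCycles i)]
    simp only [Category.assoc, hk, Preadditive.add_comp, haj, hw]
    abel
  have hki : ∀ i, IsIso (k i) := fun i => isIso_of_mono_of_epi _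
  -- the homology
  have hex : ∀ i, ∃ g : c.homology i ⟶ X i, k i ≫ c.homologyπ i ≫ g = q i := by
    intro i
    obtain ⟨i, rfl⟩ : ∃ i', i' + 1 = i := ⟨i - 1, by ring⟩
    have ht : c.toCycles i (i+1) = p i ≫ (r i).h ≫ a (i+1) ≫ k (i+1) := by
      rw [← cancel_mono (c.iCycles (i+1))]
      simp only [Category.assoc, hk, haj, c.toCycles_i, hd]
    have hz : c.toCycles i (i+1) ≫ inv (k (i+1)) ≫ q (i+1) = 0 := by
      have := (hr i).2.2.1
      rw [ht]
      simp only [Category.assoc, IsIso.hom_inv_id_assoc, haq, this, comp_zero]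
    have hf : c.homologyπ (i+1) ≫ (c.homologyIsCokernel i (i+1) (pprev i)).desc
        (CokernelCofork.ofπ _ hz) = inv (k (i+1)) ≫ q (i+1) :=
      (c.homologyIsCokernel i (i+1) (pprev i)).fac (CokernelCofork.ofπ _ hz) WalkingParallelPair.one
    exact ⟨(c.homologyIsCokernel i (i+1) (pprev i)).desc (CokernelCofork.ofπ _ hz), by
      rw [hf, IsIso.hom_inv_id_assoc]⟩
  choose g hg using hex
  have hgi : ∀ i, IsIso (g i) := by
    intro i
    have : Epi (g i) := by
      have : Epi ((k i ≫ c.homologyπ i) ≫ g i) := by rw [Category.assoc, hg]; exact hq i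
      exact epi_of_epi (k i ≫ c.homologyπ i) _
    have : Mono (g i) := by
      refine Preadditive.mono_of_cancel_zero _ (fun {T} x hx => ?_)
      obtain ⟨T', π, hπ, y, hy⟩ := surjective_up_to_refinements_of_epi (k i ≫ c.homologyπ i) x
      obtain ⟨i, rfl⟩ : ∃ i', i' + 1 = i := ⟨i - 1, by ring⟩
      have hyq : y ≫ q (i+1) = 0 := by
        have : π ≫ x ≫ g (i+1) = 0 := by rw [hx, comp_zero]
        rw [reassoc_of% hy, hg] at this
        exact this
      obtain ⟨w, hw⟩ := (hS (i+1)).lift (y ≫ j (i+1)) (by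
        rw [Category.assoc, ← hqn, reassoc_of% hyq, zero_comp])
      have hwa : w ≫ a (i+1) = y := by
        have := hj (i+1)
        rw [← cancel_mono (j (i+1)), Category.assoc, haj, hw]
      have hwm : w ≫ (r (i+1)).m = 0 := by
        rw [← haq, reassoc_of% hwa, hyq]
      obtain ⟨T₂, π₂, hπ₂, u, hu⟩ := (hr i).2.2.ref _ hwm
      obtain ⟨T₃, π₃, hπ₃, v, hv⟩ := surjective_up_to_refinements_of_epi (p i) u
      have h1 : π₃ ≫ π₂ ≫ y ≫ k (i+1) = v ≫ c.toCycles i (i+1) := by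
        rw [← cancel_mono (c.iCycles (i+1))]
        simp only [Category.assoc, hk, c.toCycles_i, hd]
        rw [← hw, reassoc_of% hu, reassoc_of% hv]
      rw [← cancel_epi π, ← cancel_epi π₂, ← cancel_epi π₃, hy, reassoc_of% h1,
        c.toCycles_comp_homologyπ]
      simp
    exact isIso_of_mono_of_epi _
  refine ⟨fun i => asIso (g i), fun i => ⟨⟨a i ≫ k i, ?_, ?_⟩, ?_⟩⟩
  · rw [Category.assoc, hk, haj]
  · simp [hg, haq]
  · rw [← cancel_epi (k i)]
    have := hg i
    simp only [asIso_hom]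
    rw [← Category.assoc (c.homologyπ i), ← Category.assoc (k i), hg, reassoc_of% hk, hqn]

end chase

section assembly
variable {A : Type} [SmallCategory A] [Abelian A] {t : ℕ} {A1 A2 X S : ZMod t → A}

lemma outIso {C : Type*} [Category C] (x : C) :
    Nonempty (IsoCl.out (Quotient.mk (isIsomorphicSetoid C) x) ≅ x) :=
  Quotient.mk_out (s := isIsomorphicSetoid C) x

lemma isoCl_eq {C : Type*} [Category C] {x : C} {M : IsoCl C} (h : Nonempty (x ≅ M.out)) :
    M = Quotient.mk (isIsomorphicSetoid C) x := by
  rw [← Quotient.out_eq M]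
  exact Quotient.sound (s := isIsomorphicSetoid C) ⟨h.some.symm⟩

/-- The class of an exact sequence in `GTotal`. -/
def mkG (M N : ZMod t → IsoCl A) (r : Raw A1 A2 X)
    (hr : r ∈ GSet A1 A2 X S (fun i => (M i).out) (fun i => (N i).out)) : GTotal A1 A2 X S :=
  ⟨(M, N), Quot.mk _ ⟨r, hr⟩⟩

lemma ker_cl {x y : A} {f g : x ⟶ y} (h : f = g) :
    (Quotient.mk (isIsomorphicSetoid A) (kernel f) : IsoCl A) =
      Quotient.mk (isIsomorphicSetoid A) (kernel g) := by
  subst h; rfl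

lemma coker_cl {x y : A} {f g : x ⟶ y} (h : f = g) :
    (Quotient.mk (isIsomorphicSetoid A) (cokernel f) : IsoCl A) =
      Quotient.mk (isIsomorphicSetoid A) (cokernel g) := by
  subst h; rfl

lemma mkG_eq {M N M' N' : ZMod t → IsoCl A} {r r' : Raw A1 A2 X}
    (hr : r ∈ GSet A1 A2 X S (fun i => (M i).out) (fun i => (N i).out))
    (hr' : r' ∈ GSet A1 A2 X S (fun i => (M' i).out) (fun i => (N' i).out))
    (h : Same r r') : mkG M N r hr = mkG M' N' r' hr' := by
  obtain ⟨l, hl⟩ := h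
  have hM : M = M' := by
    funext i
    rw [isoCl_eq (hr.2 i).2.1, isoCl_eq (hr'.2 i).2.1]
    exact ker_cl (hl i).2.2.symm
  have hN : N = N' := by
    funext i
    obtain ⟨i, rfl⟩ : ∃ i', i' + 1 = i := ⟨i - 1, by ring⟩
    rw [isoCl_eq (hr.2 i).2.2, isoCl_eq (hr'.2 i).2.2]
    exact coker_cl (hl i).2.2.symm
  subst hM hN
  exact congrArg (Sigma.mk (M, N)) (Quot.sound ⟨l, hl⟩)

lemma exists_mem (r : Raw A1 A2 X)
    (h1 : ∀ i : ZMod t, exactProp (r i).m (r i).n ∧ exactProp (r i).n (r i).h ∧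
            exactProp (r i).h (r (i + 1)).m)
    (h2 : ∀ i, Nonempty (Limits.image (r i).h ≅ S (i + 1))) :
    ∃ M N : ZMod t → IsoCl A, r ∈ GSet A1 A2 X S (fun i => (M i).out) (fun i => (N i).out) := by
  let F : ZMod t → IsoCl A := fun i => Quotient.mk (isIsomorphicSetoid A) (cokernel (r i).h)
  refine ⟨fun i => Quotient.mk (isIsomorphicSetoid A) (kernel (r i).h), fun i => F (i - 1), h1,
    fun i => ⟨h2 i, ⟨(outIso _).some.symm⟩, ?_⟩⟩
  have : F (i + 1 - 1) = F i := by rw [add_sub_cancel_right]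
  show Nonempty (cokernel (r i).h ≅ (F (i + 1 - 1)).out)
  rw [this]
  exact ⟨(outIso _).some.symm⟩

lemma dw_of_ses {c : Ct A t} (s : sesSet (mkZero A1) (mkZero A2) c) :
    DW (A1 := A1) (A2 := A2) c (fun i => s.1.1.f i) (fun i => s.1.2.f i) := by
  obtain ⟨⟨ι, p⟩, w, h⟩ := s
  refine ⟨fun i => ?_, fun i j => ?_, fun i j => ?_⟩
  · exact ⟨_, (HomologicalComplex.shortExact_iff_degreewise_shortExact _).1 h i⟩
  · have h1 : ι.f i ≫ c.d i j = (mkZero A2).d i j ≫ ι.f j := ι.comm i j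
    have h2 : (mkZero A2).d i j ≫ ι.f j = 0 := zero_comp
    exact h1.trans h2
  · have h1 : p.f i ≫ (mkZero A1).d i j = c.d i j ≫ p.f j := p.comm i j
    have h2 : p.f i ≫ (mkZero A1).d i j = 0 := comp_zero
    exact h1.symm.trans h2

/-- The extension of complexes attached to degreewise data. -/
def sesOf {c : Ct A t} {ι : ∀ i, A2 i ⟶ c.X i} {p : ∀ i, c.X i ⟶ A1 i}
    (h : DW c ι p) : sesSet (mkZero A1) (mkZero A2) c :=
  ⟨(⟨ι, fun i j _ => (h.ιd i j).trans (zero_comp (f := ι j)).symm⟩,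
    ⟨p, fun i j _ => (comp_zero (f := p i)).trans (h.dp i j).symm⟩),
    HomologicalComplex.hom_ext _ _ (fun i => (h.ses i).1),
    HomologicalComplex.shortExact_of_degreewise_shortExact _ (fun i => (h.ses i).2)⟩

lemma DW.transport {c c' : Ct A t} {ι : ∀ i, A2 i ⟶ c.X i} {p : ∀ i, c.X i ⟶ A1 i}
    (h : DW c ι p) (l : c ≅ c') :
    DW c' (fun i => ι i ≫ l.hom.f i) (fun i => l.inv.f i ≫ p i) := by
  refine ⟨fun i => ?_, fun i j => ?_, fun i j => ?_⟩
  · obtain ⟨w, hs⟩ := h.ses i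
    have w' : (ι i ≫ l.hom.f i) ≫ (l.inv.f i ≫ p i) = 0 := by simp [w]
    have iso : ShortComplex.mk (ι i) (p i) w ≅
        ShortComplex.mk (ι i ≫ l.hom.f i) (l.inv.f i ≫ p i) w' :=
      ShortComplex.isoMk (Iso.refl _) ((HomologicalComplex.eval _ _ i).mapIso l) (Iso.refl _)
        (by simp) (by simp)
    exact ⟨w', ShortComplex.shortExact_of_iso iso hs⟩
  · rw [Category.assoc, l.hom.comm, reassoc_of% (h.ιd i j), zero_comp]
  · rw [← l.inv.comm_assoc, h.dp, comp_zero]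

lemma exists_target (c : epsIdx X S) (s : sesSet (mkZero A1) (mkZero A2) c.1.out) :
    ∃ (g : (ZMod t → IsoCl A) × (ZMod t → IsoCl A)) (r : Raw A1 A2 X),
      r ∈ GSet A1 A2 X S (fun i => (g.1 i).out) (fun i => (g.2 i).out) ∧
      LES c.1.out (fun i => s.1.1.f i) (fun i => s.1.2.f i) r := by
  obtain ⟨r, hr⟩ := LES.exists (dw_of_ses s) (fun i => (c.2.1 i).some)
  obtain ⟨M, N, h⟩ := exists_mem (S := S) r (hr.exact (dw_of_ses s))
    (fun i => ⟨(hr.image (dw_of_ses s) i).some ≪≫ (c.2.2 i).some⟩)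
  exact ⟨(M, N), r, h, hr⟩

/-- The map on representatives. -/
def phi0 (c : epsIdx X S) (s : sesSet (mkZero A1) (mkZero A2) c.1.out) : GTotal A1 A2 X S :=
  mkG _ _ _ (exists_target c s).choose_spec.choose_spec.1

/-- The map from extension classes to orbits of long exact sequences. -/
def phi : eps A1 A2 X S → GTotal A1 A2 X S := fun x =>
  Quot.lift (phi0 x.1) (by
    rintro s s' ⟨l, h1, h2⟩
    refine mkG_eq _ _ (same_of_iso (dw_of_ses s') l (fun i => ?_) (fun i => ?_)
      (exists_target _ s).choose_spec.choose_spec.2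
      (exists_target _ s').choose_spec.choose_spec.2)
    · exact congrArg (fun f => HomologicalComplex.Hom.f f i) h1
    · exact congrArg (fun f => HomologicalComplex.Hom.f f i) h2) x.2

lemma phi_surj [HasExt.{0} A] (hered : ∀ X Y : A, Subsingleton (Abelian.Ext X Y 2)) :
    Function.Surjective (phi (A1 := A1) (A2 := A2) (X := X) (S := S)) := by
  rintro ⟨⟨M, N⟩, ⟨r, hr⟩⟩
  obtain ⟨c, ι, p, hD, hL⟩ := LES.construct hered r hr.1
  obtain ⟨l⟩ := outIso c
  have hD' := hD.transport l.symm
  have hL' := hL.transport l.symm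
  let x : epsIdx X S := ⟨Quotient.mk (isIsomorphicSetoid _) c,
    fun i => ⟨hL'.2.choose i⟩,
    fun i => ⟨(hL'.image hD' i).some.symm ≪≫ (hr.2 i).1.some⟩⟩
  refine ⟨⟨x, Quot.mk _ (sesOf hD')⟩, ?_⟩
  exact mkG_eq _ hr (LES.same hD' (exists_target x (sesOf hD')).choose_spec.choose_spec.2 hL')

end assembly

theorem surjection_from_extensions_onto_orbit_spaces
    (k : Type) [Field k] [Fintype k]
    (A : Type) [SmallCategory A] [Abelian A] [CategoryTheory.Linear k A]
    [HasExt.{0} A]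
    (hfinHom : ∀ X Y : A, Finite (X ⟶ Y))
    (hfinExt : ∀ X Y : A, Finite (Abelian.Ext X Y 1))
    (hered : ∀ X Y : A, Subsingleton (Abelian.Ext X Y 2))
    (t : ℕ) [NeZero t] (ht : Odd t)
    (A1 A2 X S : ZMod t → A) :
    ∃ Φ : eps A1 A2 X S → GTotal A1 A2 X S, Function.Surjective Φ := by
  exact ⟨phi, phi_surj hered⟩

end GreenDH
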